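/- For any hypergraph communication situation (N,v,H) and any player i∈N, the position value can be expressed via the Harsanyi dividends of the uniform hyperlink game: π_i(N,v,H) = Σ_{∅≠K⊆U(H)} λ_K(w)·|K_i|/|K|, where K_i = K∩U(H)(i). -/

import Mathlib

open scoped Classical
open Finset

noncomputable section

namespace HGGame

/-! ## Generic hypergraph notions -/

variable {α : Type*}

/-- Two nodes are linked if they lie in a common hyperlink of `E`. -/
def Linked (E : Finset (Finset α)) (a b : α) : Prop :=
  ∃ e ∈ E, a ∈ e ∧ b ∈ e

/-- The component of `i` in the subhypergraph of `(α, E)` induced by the ground set `S`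
(only hyperlinks contained in `S` count). -/
def compOf (E : Finset (Finset α)) (S : Finset α) (i : α) : Finset α :=
  S.filter (fun j => Relation.ReflTransGen (Linked (E.filter (fun e => e ⊆ S))) i j)

/-- The set `S/E` of components of the subhypergraph induced by `S`. -/
def components (E : Finset (Finset α)) (S : Finset α) : Finset (Finset α) :=
  S.image (compOf E S)

/-- The hypergraph-restricted worth `v^E(S) = Σ_{T ∈ S/E} v(T)`. -/
def restrictedWorth (v : Finset α → ℝ) (E : Finset (Finset α)) (S : Finset α) : ℝ :=
  ∑ T ∈ components E S, v T

/-! ## Shapley value -/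

/-- The set `σ^i` of players preceding `i` in the ordering `σ`. -/
def preceding {M : Type*} [Fintype M] (σ : M ≃ Fin (Fintype.card M)) (i : M) : Finset M :=
  Finset.univ.filter (fun j => σ j < σ i)

/-- The marginal contribution `m^σ_i(u) = u(σ^i ∪ {i}) - u(σ^i)`. -/
def marginal {M : Type*} [Fintype M] (u : Finset M → ℝ) (σ : M ≃ Fin (Fintype.card M))
    (i : M) : ℝ :=
  u (insert i (preceding σ i)) - u (preceding σ i)

/-- The Shapley value of the TU-game `(M, u)`. -/
def shapley {M : Type*} [Fintype M] (u : Finset M → ℝ) (i : M) : ℝ :=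
  ((Fintype.card M).factorial : ℝ)⁻¹ * ∑ σ : M ≃ Fin (Fintype.card M), marginal u σ i

/-- The Harsanyi dividend `λ_T(u) = Σ_{∅ ≠ S ⊆ T} (-1)^{|T|-|S|} u(S)`. -/
def dividend {M : Type*} (u : Finset M → ℝ) (T : Finset M) : ℝ :=
  ∑ S ∈ T.powerset.filter (fun S => S ≠ ∅), (-1 : ℝ) ^ (T.card - S.card) * u S

/-! ## Hypergraph communication situations -/

variable {N : Type*} [Fintype N] [DecidableEq N]

/-- The conference game `(H, v^N)`, a TU-game with player set `H`:
`v^N(H') = Σ_{T ∈ N/H'} v(T)`. -/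
def confGame (v : Finset N → ℝ) (H : Finset (Finset N)) (F : Finset {e // e ∈ H}) : ℝ :=
  restrictedWorth v (F.image Subtype.val) Finset.univ

/-- The position value `π_i(N,v,H) = Σ_{e ∈ H_i} (1/|e|) · Sh_e(H, v^N)`. -/
def positionValue (v : Finset N → ℝ) (H : Finset (Finset N)) (i : N) : ℝ :=
  ∑ e ∈ H.attach.filter (fun e => i ∈ e.val),
    ((e.val.card : ℝ))⁻¹ * shapley (confGame v H) e

/-! ## The uniform hyperlink game -/

/-- The type of agents `(i, e, k)` of the uniform hyperlink game. -/
abbrev UElem (N : Type*) := N × Finset N × ℕ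

/-- `η(H)`: the least common multiple of the hyperlink sizes. -/
def eta (H : Finset (Finset N)) : ℕ := H.lcm Finset.card

/-- `U(H)(i,e) = {(i,e,k) : k = 1, …, η(H)/|e|}`. -/
def UHie (H : Finset (Finset N)) (i : N) (e : Finset N) : Finset (UElem N) :=
  (Finset.Icc 1 (eta H / e.card)).image fun k => (i, e, k)

/-- `U(H)(i) = ∪_{e ∈ H_i} U(H)(i,e)`. -/
def UHi (H : Finset (Finset N)) (i : N) : Finset (UElem N) :=
  (H.filter (fun e => i ∈ e)).biUnion fun e => UHie H i e

/-- `U(H)(e) = ∪_{i ∈ e} U(H)(i,e)`. -/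
def UHe (H : Finset (Finset N)) (e : Finset N) : Finset (UElem N) :=
  e.biUnion fun i => UHie H i e

/-- `U(H) = ∪_{i ∈ N} U(H)(i)`. -/
def UH (H : Finset (Finset N)) : Finset (UElem N) :=
  Finset.univ.biUnion fun i : N => UHi H i

/-- `H[S] = {e ∈ H : U(H)(e) ⊆ S}`. -/
def Hof (H : Finset (Finset N)) (S : Finset (UElem N)) : Finset (Finset N) :=
  H.filter fun e => UHe H e ⊆ S

/-- The characteristic function `w(S) = Σ_{R ∈ N/H[S]} v(R)` of the uniform hyperlink game. -/
def uw (v : Finset N → ℝ) (H : Finset (Finset N)) (S : Finset (UElem N)) : ℝ :=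
  restrictedWorth v (Hof H S) Finset.univ

/-- The uniform hyperlink game `(U(H), w)` as a TU-game with player set `U(H)`. -/
def uGame (v : Finset N → ℝ) (H : Finset (Finset N)) (F : Finset {l // l ∈ UH H}) : ℝ :=
  uw v H (F.image Subtype.val)

/-! ## Harsanyi dividends -/

theorem sum_neg_one_pow_card_between {M : Type*} [Fintype M] (A K : Finset M) :
    ∑ S : Finset M, (if A ⊆ S ∧ S ⊆ K then (-1 : ℝ) ^ (S.card + K.card) else 0) =
      if A = K then 1 else 0 := by
  by_cases hAK : A ⊆ K
  · rw [← Finset.sum_filter]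
    have hfil : (univ.filter fun S : Finset M => A ⊆ S ∧ S ⊆ K) =
        (K \ A).powerset.image (A ∪ ·) := by
      ext S
      simp only [mem_filter, mem_univ, true_and, mem_image, mem_powerset]
      constructor
      · rintro ⟨h1, h2⟩
        exact ⟨S \ A, sdiff_subset_sdiff h2 le_rfl, union_sdiff_of_subset h1⟩
      · rintro ⟨B, hB, rfl⟩
        exact ⟨subset_union_left, union_subset hAK (hB.trans sdiff_subset)⟩
    have hdisj : ∀ B ∈ (K \ A).powerset, Disjoint A B := fun B hB =>
      disjoint_of_subset_right (mem_powerset.mp hB) disjoint_sdiff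
    rw [hfil, Finset.sum_image]
    · have hcard : ∀ B ∈ (K \ A).powerset, (-1 : ℝ) ^ ((A ∪ B).card + K.card) =
          (-1 : ℝ) ^ (A.card + K.card) * (-1 : ℝ) ^ B.card := by
        intro B hB
        rw [card_union_of_disjoint (hdisj B hB), ← pow_add]
        congr 1
        omega
      rw [Finset.sum_congr rfl hcard, ← Finset.mul_sum]
      have h := Finset.sum_powerset_neg_one_pow_card (x := K \ A)
      have h' : ∑ B ∈ (K \ A).powerset, (-1 : ℝ) ^ B.card = if K \ A = ∅ then 1 else 0 := by
        exact_mod_cast h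
      rw [h']
      by_cases hE : A = K
      · subst hE
        simp [← two_mul]
      · have hne : K \ A ≠ ∅ := fun h0 =>
          hE (Subset.antisymm hAK (sdiff_eq_empty_iff_subset.mp h0))
        simp [hE, hne]
    · intro B hB C hC hBC
      have h1 := (hdisj B hB)
      have h2 := (hdisj C hC)
      rw [← union_sdiff_cancel_left h1, ← union_sdiff_cancel_left h2]
      exact congrArg (· \ A) hBC
  · rw [if_neg fun h => hAK h.subset]
    exact Finset.sum_eq_zero fun S _ => if_neg fun h => hAK (h.1.trans h.2)

theorem dividend_eq_sum_univ {M : Type*} [Fintype M] {u : Finset M → ℝ} (h0 : u ∅ = 0)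
    (T : Finset M) :
    dividend u T = ∑ S : Finset M, if S ⊆ T then (-1 : ℝ) ^ (S.card + T.card) * u S else 0 := by
  rw [dividend, ← Finset.sum_filter, Finset.sum_filter_of_ne]
  · refine Finset.sum_congr (by ext S; simp) fun S hS => ?_
    have hST : S ⊆ T := by simpa using hS
    have hle := card_le_card hST
    rw [show S.card + T.card = (T.card - S.card) + 2 * S.card by omega, pow_add, pow_mul]
    simp
  · rintro S - hne rfl
    simp [h0] at hne

theorem dividend_empty {M : Type*} (u : Finset M → ℝ) : dividend u ∅ = 0 := by
  refine Finset.sum_eq_zero fun S hS => ?_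
  simp only [powerset_empty, mem_filter, mem_singleton] at hS
  exact absurd hS.1 hS.2

/-- A game is the combination of unanimity games weighted by its dividends. -/
theorem eq_sum_dividend {M : Type*} [Fintype M] {u : Finset M → ℝ} (h0 : u ∅ = 0)
    (S : Finset M) : u S = ∑ T : Finset M, dividend u T * if T ⊆ S then 1 else 0 := by
  simp_rw [dividend_eq_sum_univ h0, Finset.sum_mul]
  rw [Finset.sum_comm]
  have hinner : ∀ R : Finset M,
      ∑ T : Finset M, (if R ⊆ T then (-1 : ℝ) ^ (R.card + T.card) * u R else 0) *
        (if T ⊆ S then 1 else 0) = (if R = S then 1 else 0) * u R := by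
    intro R
    have hsign : (if R = S then 1 else 0 : ℝ) =
        (-1) ^ (R.card + S.card) * (if R = S then 1 else 0) := by
      split_ifs with h
      · simp [h, ← two_mul]
      · simp
    rw [hsign, ← sum_neg_one_pow_card_between, Finset.mul_sum, Finset.sum_mul]
    refine Finset.sum_congr rfl fun T _ => ?_
    by_cases h1 : R ⊆ T <;> by_cases h2 : T ⊆ S <;> simp only [h1, h2, and_self, and_true,
      and_false, if_true, if_false, mul_one, mul_zero, zero_mul]
    rw [← pow_add, show R.card + S.card + (T.card + S.card) = R.card + T.card + 2 * S.card by
      ring, pow_add _ _ (2 * S.card), pow_mul]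
    simp
  simp_rw [hinner]
  simp

/-- The dividends of a unanimity game. -/
theorem sum_unanimity_eq {M : Type*} [Fintype M] (A K : Finset M) :
    ∑ S : Finset M, (if S ⊆ K then (-1 : ℝ) ^ (S.card + K.card) * (if A ⊆ S then 1 else 0)
      else 0) = if A = K then 1 else 0 := by
  rw [← sum_neg_one_pow_card_between]
  refine Finset.sum_congr rfl fun S _ => ?_
  by_cases h1 : A ⊆ S <;> by_cases h2 : S ⊆ K <;> simp [h1, h2]

/-! ## The Shapley value -/

theorem notMem_preceding {M : Type*} [Fintype M] (σ : M ≃ Fin (Fintype.card M)) (i : M) :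
    i ∉ preceding σ i := by
  simp [preceding]

theorem marginal_unanimity {M : Type*} [Fintype M] (T : Finset M)
    (σ : M ≃ Fin (Fintype.card M)) (i : M) :
    marginal (fun S => if T ⊆ S then (1 : ℝ) else 0) σ i =
      if i ∈ T ∧ ∀ j ∈ T, σ j ≤ σ i then 1 else 0 := by
  unfold marginal
  by_cases hi : i ∈ T
  · have h1 : ¬ T ⊆ preceding σ i := fun h => notMem_preceding σ i (h hi)
    have h2 : T ⊆ insert i (preceding σ i) ↔ ∀ j ∈ T, σ j ≤ σ i := by
      simp only [subset_iff, mem_insert, preceding, mem_filter, mem_univ, true_and]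
      refine forall₂_congr fun j _ => ?_
      rw [le_iff_eq_or_lt, σ.injective.eq_iff]
    simp [h1, h2, hi]
  · simp [hi, subset_insert_iff_of_notMem hi]

theorem card_last_mul_card {M : Type*} [Fintype M] {T : Finset M} {i : M} (hi : i ∈ T) :
    (univ.filter fun σ : M ≃ Fin (Fintype.card M) => ∀ j ∈ T, σ j ≤ σ i).card * T.card =
      (Fintype.card M).factorial := by
  set c : M → Finset (M ≃ Fin (Fintype.card M)) :=
    fun k => univ.filter fun σ => ∀ j ∈ T, σ j ≤ σ k with hc
  have hsym : ∀ k ∈ T, (c k).card = (c i).card := by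
    intro k hk
    have hswap : ∀ j ∈ T, Equiv.swap i k j ∈ T := by
      intro j hj
      rw [Equiv.swap_apply_def]
      split_ifs <;> assumption
    refine Finset.card_bij' (fun σ _ => (Equiv.swap i k).trans σ)
      (fun σ _ => (Equiv.swap i k).trans σ) ?_ ?_ ?_ ?_
    · intro σ hσ
      simp only [hc, mem_filter, mem_univ, true_and] at hσ ⊢
      intro j hj
      simpa using hσ _ (hswap j hj)
    · intro σ hσ
      simp only [hc, mem_filter, mem_univ, true_and] at hσ ⊢
      intro j hj
      simpa using hσ _ (hswap j hj)
    · intro σ _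
      ext j
      simp
    · intro σ _
      ext j
      simp
  have hunion : T.biUnion c = univ := by
    ext σ
    simp only [hc, mem_biUnion, mem_filter, mem_univ, true_and, iff_true]
    exact T.exists_max_image σ ⟨i, hi⟩
  have hdisj : (T : Set M).PairwiseDisjoint c := by
    intro k hk l hl hkl
    refine Finset.disjoint_left.mpr fun σ h1 h2 => hkl ?_
    simp only [hc, mem_filter, mem_univ, true_and] at h1 h2
    exact σ.injective (le_antisymm (h2 k hk) (h1 l hl))
  have htotal : ∑ k ∈ T, (c k).card = (Fintype.card M).factorial := by
    rw [← card_biUnion hdisj, hunion, card_univ, Fintype.card_equiv (Fintype.equivFin M)]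
  rw [← htotal, Finset.sum_congr rfl hsym, sum_const, smul_eq_mul, mul_comm]

theorem shapley_unanimity {M : Type*} [Fintype M] (T : Finset M) (i : M) :
    shapley (fun S => if T ⊆ S then (1 : ℝ) else 0) i = if i ∈ T then (T.card : ℝ)⁻¹ else 0 := by
  simp_rw [shapley, marginal_unanimity]
  by_cases hi : i ∈ T
  · have hT : (T.card : ℝ) ≠ 0 := by exact_mod_cast (card_pos.mpr ⟨i, hi⟩).ne'
    have hf : ((Fintype.card M).factorial : ℝ) ≠ 0 := by positivity
    have hcount : ((univ.filter fun σ : M ≃ Fin (Fintype.card M) =>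
        ∀ j ∈ T, σ j ≤ σ i).card : ℝ) * T.card = (Fintype.card M).factorial := by
      exact_mod_cast card_last_mul_card hi
    simp only [hi, true_and, if_true, Finset.sum_boole]
    rw [← mul_eq_one_iff_eq_inv₀ hT, mul_assoc, hcount, inv_mul_cancel₀ hf]
  · simp [hi]

/-- The Shapley value distributes each dividend equally. -/
theorem shapley_eq_sum_dividend {M : Type*} [Fintype M] {u : Finset M → ℝ} (h0 : u ∅ = 0)
    (i : M) :
    shapley u i = ∑ T : Finset M, dividend u T * if i ∈ T then (T.card : ℝ)⁻¹ else 0 := by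
  simp_rw [← shapley_unanimity, shapley, marginal]
  simp_rw [eq_sum_dividend h0 (insert _ _), eq_sum_dividend h0 (preceding _ _),
    ← Finset.sum_sub_distrib, ← mul_sub]
  rw [Finset.sum_comm, Finset.mul_sum]
  refine Finset.sum_congr rfl fun T _ => ?_
  rw [← Finset.mul_sum]
  ring

/-! ## The uniform hyperlink game in terms of the conference game -/

section UniformHyperlink

variable {N : Type*}

theorem restrictedWorth_empty {v : Finset N → ℝ} (hzn : ∀ i : N, v {i} = 0) (S : Finset N) :
    restrictedWorth v ∅ S = 0 := by
  refine Finset.sum_eq_zero fun T hT => ?_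
  obtain ⟨i, hi, rfl⟩ := mem_image.mp hT
  convert hzn i
  ext j
  simp only [compOf, filter_empty, mem_filter, mem_singleton]
  constructor
  · rintro ⟨-, h⟩
    induction h with
    | refl => rfl
    | tail _ h _ =>
      obtain ⟨e, he, -⟩ := h
      simp at he
  · rintro rfl
    exact ⟨hi, .refl⟩

theorem eta_ne_zero {H : Finset (Finset N)} (hH : ∀ e ∈ H, 1 < e.card) : eta H ≠ 0 := by
  rw [eta, Ne, Finset.lcm_eq_zero_iff]
  rintro ⟨e, he, h0⟩
  have := hH e he
  omega

variable [DecidableEq N]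

theorem mem_UHie {H : Finset (Finset N)} {i : N} {e : Finset N} {l : UElem N} :
    l ∈ UHie H i e ↔ l.1 = i ∧ l.2.1 = e ∧ l.2.2 ∈ Icc 1 (eta H / e.card) := by
  obtain ⟨j, f, k⟩ := l
  simp only [UHie, mem_image, Prod.mk.injEq]
  constructor
  · rintro ⟨k', hk', rfl, rfl, rfl⟩
    exact ⟨rfl, rfl, hk'⟩
  · rintro ⟨rfl, rfl, hk⟩
    exact ⟨k, hk, rfl, rfl, rfl⟩

theorem card_UHie (H : Finset (Finset N)) (i : N) (e : Finset N) :
    (UHie H i e).card = eta H / e.card := by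
  rw [UHie, card_image_of_injective _ fun a b h => by simpa using h, Nat.card_Icc,
    Nat.add_sub_cancel]

theorem card_UHe {H : Finset (Finset N)} {e : Finset N} (he : e ∈ H) :
    (UHe H e).card = eta H := by
  rw [UHe, card_biUnion]
  · simp_rw [card_UHie]
    rw [sum_const, smul_eq_mul]
    exact Nat.mul_div_cancel' (Finset.dvd_lcm he)
  · intro i _ j _ hij
    refine Finset.disjoint_left.mpr fun l h1 h2 => hij ?_
    exact (mem_UHie.mp h1).1.symm.trans (mem_UHie.mp h2).1

theorem mem_UHe_link {H : Finset (Finset N)} {e : Finset N} {l : UElem N}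
    (hl : l ∈ UHe H e) : l.2.1 = e := by
  obtain ⟨i, -, hl⟩ := mem_biUnion.mp hl
  exact (mem_UHie.mp hl).2.1

variable [Fintype N]

theorem confGame_empty {v : Finset N → ℝ} (hzn : ∀ i : N, v {i} = 0) (H : Finset (Finset N)) :
    confGame v H ∅ = 0 := by
  rw [confGame, image_empty, restrictedWorth_empty hzn]

theorem UHe_subset_UH {H : Finset (Finset N)} {e : Finset N} (he : e ∈ H) :
    UHe H e ⊆ UH H := by
  intro l hl
  obtain ⟨i, hi, hl⟩ := mem_biUnion.mp hl
  exact mem_biUnion.mpr ⟨i, mem_univ i, mem_biUnion.mpr ⟨e, mem_filter.mpr ⟨he, hi⟩, hl⟩⟩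

/-- The agents of the uniform hyperlink game that belong to some hyperlink of `T`. -/
def agentsOf (H : Finset (Finset N)) (T : Finset {e // e ∈ H}) : Finset {l // l ∈ UH H} :=
  univ.filter fun l => ∃ e ∈ T, l.val ∈ UHe H e.val

theorem card_agentsOf (H : Finset (Finset N)) (T : Finset {e // e ∈ H}) :
    (agentsOf H T).card = T.card * eta H := by
  have himg : (agentsOf H T).image Subtype.val = T.biUnion fun e => UHe H e.val := by
    ext l
    simp only [agentsOf, mem_image, mem_filter, mem_univ, true_and, mem_biUnion]
    constructor
    · rintro ⟨l, h, rfl⟩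
      exact h
    · rintro ⟨e, he, hl⟩
      exact ⟨⟨l, UHe_subset_UH e.2 hl⟩, ⟨e, he, hl⟩, rfl⟩
  rw [← card_image_of_injective _ Subtype.val_injective, himg, card_biUnion,
    Finset.sum_congr rfl fun e _ => card_UHe e.2, sum_const, smul_eq_mul]
  intro e _ f _ hef
  refine Finset.disjoint_left.mpr fun l h1 h2 => hef ?_
  exact Subtype.ext ((mem_UHe_link h1).symm.trans (mem_UHe_link h2))

theorem card_agentsOf_filter (H : Finset (Finset N)) (T : Finset {e // e ∈ H}) (i : N) :
    ((agentsOf H T).filter fun l => l.val ∈ UHi H i).card =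
      ∑ e ∈ T.filter (fun e => i ∈ e.val), eta H / e.val.card := by
  have himg : ((agentsOf H T).filter fun l => l.val ∈ UHi H i).image Subtype.val =
      (T.filter fun e => i ∈ e.val).biUnion fun e => UHie H i e.val := by
    ext l
    simp only [agentsOf, mem_image, mem_filter, mem_univ, true_and, mem_biUnion]
    constructor
    · rintro ⟨l, ⟨⟨e, he, hl⟩, hli⟩, rfl⟩
      obtain ⟨f, hf, hlf⟩ := mem_biUnion.mp hli
      obtain rfl : f = e.val := (mem_UHie.mp hlf).2.1.symm.trans (mem_UHe_link hl)
      exact ⟨e, ⟨he, (mem_filter.mp hf).2⟩, hlf⟩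
    · rintro ⟨e, ⟨he, hi⟩, hl⟩
      have hle : l ∈ UHe H e.val := mem_biUnion.mpr ⟨i, hi, hl⟩
      exact ⟨⟨l, UHe_subset_UH e.2 hle⟩, ⟨⟨e, he, hle⟩,
        mem_biUnion.mpr ⟨e.val, mem_filter.mpr ⟨e.2, hi⟩, hl⟩⟩, rfl⟩
  rw [← card_image_of_injective _ Subtype.val_injective, himg, card_biUnion,
    Finset.sum_congr rfl fun e _ => card_UHie H i e.val]
  intro e _ f _ hef
  refine Finset.disjoint_left.mpr fun l h1 h2 => hef ?_
  exact Subtype.ext ((mem_UHie.mp h1).2.1.symm.trans (mem_UHie.mp h2).2.1)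

theorem uGame_eq_sum {v : Finset N → ℝ} (hzn : ∀ i : N, v {i} = 0) (H : Finset (Finset N))
    (S : Finset {l // l ∈ UH H}) :
    uGame v H S =
      ∑ T, dividend (confGame v H) T * if agentsOf H T ⊆ S then 1 else 0 := by
  have hconf : uGame v H S =
      confGame v H (univ.filter fun e => UHe H e.val ⊆ S.image Subtype.val) := by
    unfold uGame uw confGame
    congr 1
    ext e
    simp [Hof, and_comm]
  rw [hconf, eq_sum_dividend (confGame_empty hzn H)]
  refine Finset.sum_congr rfl fun T _ => ?_
  congr 2
  simp only [eq_iff_iff, subset_iff, mem_filter, mem_univ, true_and, agentsOf, mem_image]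
  constructor
  · rintro h l ⟨e, he, hl⟩
    obtain ⟨l', hl', heq⟩ := h he hl
    rwa [← Subtype.ext heq]
  · intro h e he l hl
    exact ⟨⟨l, UHe_subset_UH e.2 hl⟩, h ⟨e, he, hl⟩, rfl⟩

theorem agentsOf_eq_empty_iff {H : Finset (Finset N)} (hH : ∀ e ∈ H, 1 < e.card)
    (T : Finset {e // e ∈ H}) : agentsOf H T = ∅ ↔ T = ∅ := by
  rw [← card_eq_zero, card_agentsOf, mul_eq_zero, or_iff_left (eta_ne_zero hH), card_eq_zero]

theorem dividend_uGame {v : Finset N → ℝ} (hzn : ∀ i : N, v {i} = 0) {H : Finset (Finset N)}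
    (hH : ∀ e ∈ H, 1 < e.card) (K : Finset {l // l ∈ UH H}) :
    dividend (uGame v H) K =
      ∑ T, dividend (confGame v H) T * if agentsOf H T = K then 1 else 0 := by
  have h0 : uGame v H ∅ = 0 := by
    rw [uGame_eq_sum hzn]
    refine Finset.sum_eq_zero fun T _ => ?_
    simp only [subset_empty, agentsOf_eq_empty_iff hH]
    split_ifs with h
    · rw [h, dividend_empty, zero_mul]
    · rw [mul_zero]
  have hun : ∀ T, (if agentsOf H T = K then (1 : ℝ) else 0) =
      ∑ S, if S ⊆ K then (-1 : ℝ) ^ (S.card + K.card) * (if agentsOf H T ⊆ S then 1 else 0)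
        else 0 := fun T => by
    convert (sum_unanimity_eq (agentsOf H T) K).symm
  simp_rw [dividend_eq_sum_univ h0, uGame_eq_sum hzn, hun, Finset.mul_sum]
  rw [Finset.sum_comm]
  refine Finset.sum_congr rfl fun S _ => ?_
  split_ifs with h
  · exact Finset.sum_congr rfl fun T _ => by ring
  · simp

end UniformHyperlink

/-- Expression of the position value via Harsanyi dividends of the uniform hyperlink game:
`π_i(N,v,H) = Σ_{∅ ≠ K ⊆ U(H)} λ_K(w)·|K_i|/|K|` with `K_i = K ∩ U(H)(i)`. -/
theorem position_value_eq_dividend_formula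
    {N : Type*} [Fintype N] [DecidableEq N]
    (v : Finset N → ℝ) (H : Finset (Finset N))
    (hN : 2 ≤ Fintype.card N)
    (hv0 : v ∅ = 0) (hzn : ∀ i : N, v {i} = 0)
    (hH : ∀ e ∈ H, 1 < e.card) (i : N) :
    positionValue v H i =
      ∑ K ∈ (Finset.univ : Finset (Finset {l // l ∈ UH H})).filter (fun K => K ≠ ∅),
        dividend (uGame v H) K *
          ((K.filter (fun l => l.val ∈ UHi H i)).card : ℝ) / (K.card : ℝ) := by
  have hη : (eta H : ℝ) ≠ 0 := by exact_mod_cast eta_ne_zero hH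
  rw [Finset.sum_filter_of_ne]
  · simp_rw [dividend_uGame hzn hH, mul_div_assoc, Finset.sum_mul]
    rw [Finset.sum_comm]
    simp only [mul_assoc, ite_mul, one_mul, zero_mul, mul_ite, mul_zero, Finset.sum_ite_eq,
      mem_univ, if_true]
    simp_rw [positionValue, shapley_eq_sum_dividend (confGame_empty hzn H), Finset.mul_sum]
    rw [Finset.sum_comm]
    refine Finset.sum_congr rfl fun T _ => ?_
    rw [card_agentsOf_filter, card_agentsOf]
    push_cast
    rw [Finset.sum_div, Finset.mul_sum]
    simp only [Finset.sum_filter, mul_ite, mul_zero]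
    rw [← Finset.sum_subset (fun e _ => mem_attach H e : T ⊆ H.attach)
      fun e _ he => by simp [he]]
    refine Finset.sum_congr rfl fun e he => ?_
    have hc : (e.val.card : ℝ) ≠ 0 := by
      have := hH e.val e.2
      exact_mod_cast (by omega : e.val.card ≠ 0)
    have hT : (T.card : ℝ) ≠ 0 := by exact_mod_cast (card_pos.mpr ⟨e, he⟩).ne'
    have hdvd : e.val.card ∣ eta H := Finset.dvd_lcm e.2
    rw [if_pos he, Nat.cast_div hdvd hc]
    split_ifs with hi
    · field_simp
    · rfl
  · rintro K - hne rfl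
    simp [dividend_empty] at hne

end HGGame
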